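/- arXiv:2011.05164 — 6 statements merged into one kernel-verified Lean document; each statement's English description precedes it below -/
import Mathlib

section
/- Let M be an n×n complex anti-symmetric matrix (Mᵀ = -M). Then every non-zero eigenvalue of the positive semidefinite Hermitian matrix M * Mᴴ has even algebraic multiplicity; equivalently, the non-zero singular values of M come in pairs. -/
open Matrix Polynomial

/-- An invertible skew-symmetric matrix over a field of characteristic zero has even size. -/
theorem Matrix.even_card_of_transpose_eq_neg {ι K : Type*} [Fintype ι] [DecidableEq ι] [Field K]
    [CharZero K] {N : Matrix ι ι K} (hN : Nᵀ = -N) (hdet : N.det ≠ 0) :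
    Even (Fintype.card ι) := by
  have h : N.det = (-1) ^ Fintype.card ι * N.det := by
    rw [← det_neg, ← hN, det_transpose]
  by_contra hodd
  rw [Nat.not_even_iff_odd] at hodd
  rw [hodd.neg_one_pow, neg_one_mul] at h
  exact hdet (self_eq_neg.mp h)

/-- If `K` is skew-symmetric and `K * Kᴴ` is diagonal, then each non-zero entry occurs an even
number of times on the diagonal. -/
theorem Matrix.even_card_of_mul_conjTranspose_eq_diagonal {ι : Type*} [Fintype ι] [DecidableEq ι]
    {K : Matrix ι ι ℂ} (hK : Kᵀ = -K) {d : ι → ℂ} (hd : K * Kᴴ = diagonal d)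
    {μ : ℂ} (hμ : μ ≠ 0) : Even (Fintype.card {i // d i = μ}) := by
  have hd' : Kᴴ * K = diagonal d := by
    have h := congrArg transpose hd
    have hstar : Kᴴᵀ = -Kᴴ := by
      rw [← conjTranspose_neg, ← hK]
      rfl
    rw [transpose_mul, hK, hstar, neg_mul_neg, diagonal_transpose] at h
    exact h
  have hcomm : K * diagonal d = diagonal d * K := by
    nth_rw 1 [← hd', ← hd, Matrix.mul_assoc]
  have hzero : ∀ i j, d i ≠ d j → K i j = 0 := by
    intro i j hij
    have h := congrFun (congrFun hcomm i) j
    rw [mul_diagonal, diagonal_mul, mul_comm, ← sub_eq_zero, ← sub_mul] at h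
    exact (mul_eq_zero.mp h).resolve_left (sub_ne_zero.mpr hij.symm)
  let N : Matrix {i // d i = μ} {i // d i = μ} ℂ := K.submatrix (↑) (↑)
  have hN : Nᵀ = -N := by
    ext i j
    exact congrFun (congrFun hK i) j
  have hmul : N * Nᴴ = diagonal fun _ => μ := by
    ext i j
    have h := congrFun (congrFun hd i) j
    rw [mul_apply] at h ⊢
    have hsum : ∑ l : {i // d i = μ}, N i l * Nᴴ l j = ∑ l, K i l * Kᴴ l j := by
      rw [← Fintype.sum_subtype_add_sum_subtype (fun l => d l = μ) fun l => K i l * Kᴴ l j]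
      refine (add_eq_left.mpr (Finset.sum_eq_zero fun l _ => ?_)).symm
      rw [hzero i l (i.2.trans_ne (Ne.symm l.2)), zero_mul]
    rw [hsum, h]
    by_cases hij : i = j
    · subst hij
      simp [i.2]
    · simp [hij, Subtype.coe_injective.ne hij]
  refine even_card_of_transpose_eq_neg hN fun h0 => ?_
  have h := congrArg det hmul
  rw [det_mul, h0, zero_mul, det_diagonal] at h
  exact Finset.prod_ne_zero_iff.mpr (fun _ _ => hμ) h.symm

/-- For a complex anti-symmetric matrix `M`, every non-zero eigenvalue of
`M * Mᴴ` has even algebraic multiplicity (the non-zero singular values of `M` pair up). -/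
theorem antisymm_singular_values_paired (n : ℕ)
    (M : Matrix (Fin n) (Fin n) ℂ) (hM : Mᵀ = -M)
    (μ : ℂ) (hμ : μ ≠ 0) :
    Even ((M * Mᴴ).charpoly.rootMultiplicity μ) := by
  have hH : (M * Mᴴ).IsHermitian := isHermitian_mul_conjTranspose_self M
  let U : Matrix (Fin n) (Fin n) ℂ := hH.eigenvectorUnitary
  have hUU : U * Uᴴ = 1 := Unitary.coe_mul_star_self hH.eigenvectorUnitary
  have hUUt : Uᴴᵀ * Uᵀ = 1 := by
    rw [← transpose_mul, hUU, transpose_one]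
  have hdiag : Uᴴ * (M * Mᴴ) * U = diagonal (RCLike.ofReal ∘ hH.eigenvalues) := by
    rw [← hH.conjStarAlgAut_star_eigenvectorUnitary, Unitary.conjStarAlgAut_star_apply]
    rfl
  have hK : (Uᴴ * M * Uᴴᵀ)ᵀ = -(Uᴴ * M * Uᴴᵀ) := by
    simp [transpose_mul, hM, Matrix.mul_assoc]
  have hKK : Uᴴ * M * Uᴴᵀ * (Uᴴ * M * Uᴴᵀ)ᴴ = diagonal (RCLike.ofReal ∘ hH.eigenvalues) := by
    have hstar : Uᴴᵀᴴ = Uᵀ := by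
      ext i j
      simp
    rw [← hdiag, conjTranspose_mul, conjTranspose_mul, hstar, conjTranspose_conjTranspose]
    calc Uᴴ * M * Uᴴᵀ * (Uᵀ * (Mᴴ * U)) = Uᴴ * M * (Uᴴᵀ * Uᵀ) * (Mᴴ * U) := by
          simp only [Matrix.mul_assoc]
      _ = Uᴴ * (M * Mᴴ) * U := by
          rw [hUUt, Matrix.mul_one]
          simp only [Matrix.mul_assoc]
  have h := even_card_of_mul_conjTranspose_eq_diagonal hK hKK hμ
  rw [← count_roots, hH.roots_charpoly_eq_eigenvalues, Multiset.count_map]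
  rw [Fintype.card_subtype] at h
  simpa [Finset.card_def, eq_comm] using h
end

section
/- Let M be an n×n complex anti-symmetric matrix (Mᵀ = -M). Then there exist an n×n real anti-symmetric matrix E (Eᵀ = -E) and an n×n unitary complex matrix U such that M * Mᴴ = U * (Ẽ * Ẽᴴ) * Uᴴ, where Ẽ is the complex matrix obtained by mapping the entries of E into ℂ. In particular, M * Mᴴ and Ẽ * Ẽᴴ have the same eigenvalues. -/
open Matrix

/-- An antisymmetric matrix with nonzero determinant has even size. -/
theorem even_card_of_transpose_eq_neg {ι : Type*} [Fintype ι] [DecidableEq ι]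
    {A : Matrix ι ι ℂ} (hA : Aᵀ = -A) (hdet : A.det ≠ 0) : Even (Fintype.card ι) := by
  by_contra h
  rw [Nat.not_even_iff_odd] at h
  have := congrArg Matrix.det hA
  rw [det_transpose, det_neg, h.neg_one_pow, neg_one_mul, self_eq_neg] at this
  exact hdet this

/-- On an even number of coordinates there is a real antisymmetric orthogonal matrix. -/
theorem exists_transpose_eq_neg_mul_transpose_eq_one {ι : Type*} [Fintype ι] [DecidableEq ι]
    (h : Even (Fintype.card ι)) : ∃ A : Matrix ι ι ℝ, Aᵀ = -A ∧ A * Aᵀ = 1 := by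
  obtain ⟨k, hk⟩ := h
  have e : ι ≃ Fin k ⊕ Fin k := Fintype.equivOfCardEq (by simpa using hk)
  refine ⟨(Matrix.J (Fin k) ℝ).submatrix e e, ?_, ?_⟩
  · rw [transpose_submatrix, J_transpose]
    rfl
  · rw [transpose_submatrix, submatrix_mul_equiv, J_transpose, mul_neg, J_squared, neg_neg,
      submatrix_one_equiv]

/-- If each nonzero value of `d ≥ 0` is attained an even number of times, then `diagonal d` is of
the form `E * Eᵀ` with `E` real antisymmetric. -/
theorem exists_transpose_eq_neg_mul_transpose_eq_diagonal {ι : Type*} [Fintype ι] [DecidableEq ι]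
    (d : ι → ℝ) (hd : ∀ i, 0 ≤ d i)
    (heven : ∀ c, c ≠ 0 → Even (Fintype.card {i // d i = c})) :
    ∃ E : Matrix ι ι ℝ, Eᵀ = -E ∧ E * Eᵀ = diagonal d := by
  have hB (c : Set.range d) : ∃ B : Matrix {i // d i = c} {i // d i = c} ℝ,
      Bᵀ = -B ∧ B * Bᵀ = diagonal fun _ ↦ (c : ℝ) := by
    obtain ⟨c, i, rfl⟩ := c
    by_cases hc : d i = 0
    · exact ⟨0, by simp, by simp [hc]⟩
    · obtain ⟨A, hA, hA'⟩ := exists_transpose_eq_neg_mul_transpose_eq_one (heven _ hc)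
      refine ⟨√(d i) • A, by simp [hA], ?_⟩
      rw [transpose_smul, smul_mul_smul_comm, hA', Real.mul_self_sqrt (hd i), smul_one_eq_diagonal]
  choose B hB hB' using hB
  let e : ι ≃ Σ c : Set.range d, {i // d i = c} :=
    { toFun := fun i ↦ ⟨⟨d i, i, rfl⟩, i, rfl⟩
      invFun := fun x ↦ x.2
      left_inv := fun _ ↦ rfl
      right_inv := by
        rintro ⟨⟨c, hc⟩, i, hi⟩
        change d i = c at hi
        subst hi
        rfl }
  refine ⟨(blockDiagonal' B).submatrix e e, ?_, ?_⟩
  · rw [transpose_submatrix, blockDiagonal'_transpose, funext hB]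
    exact congrArg (fun X ↦ X.submatrix e e) (blockDiagonal'_neg B)
  · rw [transpose_submatrix, submatrix_mul_equiv, blockDiagonal'_transpose, ← blockDiagonal'_mul,
      funext hB', blockDiagonal'_diagonal, submatrix_diagonal_equiv]
    rfl

/-- If `N` is antisymmetric and `N * Nᴴ` is diagonal, then each nonzero diagonal entry is attained
an even number of times. -/
theorem even_card_fiber_of_mul_conjTranspose_eq_diagonal {ι : Type*} [Fintype ι] [DecidableEq ι]
    {N : Matrix ι ι ℂ} (hN : Nᵀ = -N) {d : ι → ℝ} (hd : N * Nᴴ = diagonal fun i ↦ (d i : ℂ))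
    {c : ℝ} (hc : c ≠ 0) : Even (Fintype.card {i // d i = c}) := by
  have hd' : Nᴴ * N = diagonal fun i ↦ (d i : ℂ) := by
    have h := congrArg transpose hd
    have hconj : Nᴴᵀ = -Nᴴ := by
      rw [← conjTranspose_neg, ← hN]
      rfl
    rwa [transpose_mul, diagonal_transpose, hN, hconj, neg_mul_neg] at h
  have hcomm : N * diagonal (fun i ↦ (d i : ℂ)) = diagonal (fun i ↦ (d i : ℂ)) * N := by
    rw [← hd', ← mul_assoc, hd, hd']
  have hzero {i j : ι} (hij : d j ≠ d i) : N i j = 0 := by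
    have h := congrFun (congrFun hcomm i) j
    rw [mul_diagonal, diagonal_mul, mul_comm] at h
    by_contra h0
    exact hij (by exact_mod_cast mul_right_cancel₀ h0 h)
  let A : Matrix {i // d i = c} {i // d i = c} ℂ := N.submatrix (↑) (↑)
  have hA : A * Aᴴ = diagonal fun _ ↦ (c : ℂ) := by
    ext i j
    have h := congrFun (congrFun hd i) j
    rw [mul_apply, ← Fintype.sum_subtype_add_sum_subtype (fun k ↦ d k = c),
      Finset.sum_eq_zero (s := (Finset.univ : Finset {k // ¬ d k = c})), add_zero] at h
    · refine h.trans ?_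
      simp [diagonal_apply, Subtype.ext_iff, i.2]
    · rintro k -
      rw [hzero (by rw [i.2]; exact k.2), zero_mul]
  refine even_card_of_transpose_eq_neg (A := A) ?_ fun h0 ↦ ?_
  · rw [transpose_submatrix, hN]
    rfl
  · have h := congrArg det hA
    rw [det_mul, h0, zero_mul, det_diagonal] at h
    exact Finset.prod_ne_zero_iff.mpr (fun _ _ ↦ by exact_mod_cast hc) h.symm

open scoped ComplexOrder in
/-- Unitary diagonalization of `M * Mᴴ`, with nonnegative real diagonal. -/
theorem exists_unitary_mul_conjTranspose_self_eq {ι : Type*} [Fintype ι] [DecidableEq ι]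
    (M : Matrix ι ι ℂ) : ∃ V ∈ unitaryGroup ι ℂ, ∃ d : ι → ℝ, (∀ i, 0 ≤ d i) ∧
      M * Mᴴ = V * diagonal (fun i ↦ (d i : ℂ)) * Vᴴ := by
  have hpos : (M * Mᴴ).PosSemidef := posSemidef_self_mul_conjTranspose M
  exact ⟨hpos.isHermitian.eigenvectorUnitary, hpos.isHermitian.eigenvectorUnitary.2,
    hpos.isHermitian.eigenvalues, hpos.eigenvalues_nonneg, hpos.isHermitian.spectral_theorem⟩


/-- For a complex anti-symmetric matrix `M`, there exist a real
anti-symmetric matrix `E` and a unitary matrix `U` such that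
`M * Mᴴ = U * (Ẽ * Ẽᴴ) * Uᴴ`, where `Ẽ` is the complexification of `E`. -/
theorem antisymm_characteristic_exists (n : ℕ)
    (M : Matrix (Fin n) (Fin n) ℂ) (hM : Mᵀ = -M) :
    ∃ (E : Matrix (Fin n) (Fin n) ℝ) (U : Matrix (Fin n) (Fin n) ℂ),
      Eᵀ = -E ∧ U ∈ Matrix.unitaryGroup (Fin n) ℂ ∧
      M * Mᴴ = U * (E.map Complex.ofReal * (E.map Complex.ofReal)ᴴ) * Uᴴ := by
  obtain ⟨V, hV, d, hd, hspec⟩ := exists_unitary_mul_conjTranspose_self_eq M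
  have hVV : Vᴴ * V = 1 := mem_unitaryGroup_iff'.mp hV
  have hVV' : Vᵀᴴ * Vᵀ = 1 := by
    have h := congrArg transpose (mem_unitaryGroup_iff.mp hV)
    rwa [transpose_mul, transpose_one] at h
  have hN : (Vᴴ * M * Vᵀᴴ)ᵀ = -(Vᴴ * M * Vᵀᴴ) := by
    have h : Vᵀᴴᵀ = Vᴴ := rfl
    have h' : Vᴴᵀ = Vᵀᴴ := rfl
    rw [transpose_mul, transpose_mul, hM, h, h', neg_mul, mul_neg, mul_assoc]
  have hNN : (Vᴴ * M * Vᵀᴴ) * (Vᴴ * M * Vᵀᴴ)ᴴ = diagonal fun i ↦ (d i : ℂ) := by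
    calc (Vᴴ * M * Vᵀᴴ) * (Vᴴ * M * Vᵀᴴ)ᴴ = Vᴴ * M * (Vᵀᴴ * Vᵀ) * Mᴴ * V := by
          simp only [conjTranspose_mul, conjTranspose_conjTranspose, mul_assoc]
      _ = Vᴴ * (M * Mᴴ) * V := by rw [hVV', mul_one, mul_assoc Vᴴ]
      _ = (Vᴴ * V) * diagonal (fun i ↦ (d i : ℂ)) * (Vᴴ * V) := by
          rw [hspec]
          simp only [mul_assoc]
      _ = diagonal fun i ↦ (d i : ℂ) := by rw [hVV, one_mul, mul_one]
  obtain ⟨E, hE, hEE⟩ := exists_transpose_eq_neg_mul_transpose_eq_diagonal d hd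
    fun c hc ↦ even_card_fiber_of_mul_conjTranspose_eq_diagonal hN hNN hc
  refine ⟨E, V, hE, hV, ?_⟩
  have hmap : E.map Complex.ofReal * (E.map Complex.ofReal)ᴴ = diagonal fun i ↦ (d i : ℂ) := by
    have h : (E.map Complex.ofReal)ᴴ = Eᵀ.map Complex.ofReal := by
      ext i j
      simp
    have h' := congrArg (fun X ↦ X.map Complex.ofRealHom) hEE
    rw [Matrix.map_mul, diagonal_map (map_zero _)] at h'
    rw [h]
    exact h'
  rw [hmap, hspec]
end

section
/- Let m be a natural number and ε : Fin m → ℝ. Let D be the 2m×2m complex diagonal matrix whose diagonal entries are i·ε₁, -i·ε₁, i·ε₂, -i·ε₂, …, i·εₘ, -i·εₘ (i the imaginary unit). Then there exist a 2m×2m real anti-symmetric matrix E (Eᵀ = -E) and a 2m×2m unitary complex matrix V such that D = V * Ẽ * Vᴴ, where Ẽ is the complex matrix obtained by mapping the entries of E into ℂ. -/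
open Matrix

/-- The unitary matrix `(1/√2) [[1, -i], [1, i]]`, which diagonalizes every real
anti-symmetric `2 × 2` matrix. -/
noncomputable def rotationDiagonalizer : Matrix (Fin 2) (Fin 2) ℂ :=
  ((√2 : ℝ) : ℂ)⁻¹ • !![1, -Complex.I; 1, Complex.I]

lemma inv_sqrt_two_mul_self : ((√2 : ℝ) : ℂ)⁻¹ * ((√2 : ℝ) : ℂ)⁻¹ = 1 / 2 := by
  rw [← mul_inv, ← Complex.ofReal_mul, Real.mul_self_sqrt (by norm_num)]
  norm_num

lemma rotationDiagonalizer_conjTranspose :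
    rotationDiagonalizerᴴ = ((√2 : ℝ) : ℂ)⁻¹ • !![1, 1; Complex.I, -Complex.I] := by
  ext i j
  fin_cases i <;> fin_cases j <;> simp [rotationDiagonalizer]

lemma rotationDiagonalizer_mul_conjTranspose :
    rotationDiagonalizer * rotationDiagonalizerᴴ = 1 := by
  rw [rotationDiagonalizer_conjTranspose, rotationDiagonalizer, smul_mul_smul_comm,
    inv_sqrt_two_mul_self]
  ext i j
  fin_cases i <;> fin_cases j <;> simp <;> norm_num

lemma rotationDiagonalizer_conj (x : ℝ) :
    rotationDiagonalizer * (!![0, x; -x, 0] : Matrix (Fin 2) (Fin 2) ℝ).map Complex.ofReal *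
      rotationDiagonalizerᴴ = diagonal ![Complex.I * x, -Complex.I * x] := by
  have h_map : (!![0, x; -x, 0] : Matrix (Fin 2) (Fin 2) ℝ).map Complex.ofReal =
      !![0, (x : ℂ); -x, 0] := by
    ext i j
    fin_cases i <;> fin_cases j <;> simp
  rw [h_map, rotationDiagonalizer_conjTranspose, rotationDiagonalizer, smul_mul,
    smul_mul_smul_comm, inv_sqrt_two_mul_self, mul_fin_two, mul_fin_two]
  ext i j
  fin_cases i <;> fin_cases j <;> simp <;> ring

/-- The equivalence sending `j` to `(j % 2, j / 2)`. -/
def finTwoMulEquiv (m : ℕ) : Fin (2 * m) ≃ Fin 2 × Fin m :=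
  (finCongr (Nat.mul_comm 2 m)).trans (finProdFinEquiv.symm.trans (Equiv.prodComm _ _))

/-- The `2m × 2m` complex diagonal matrix with diagonal entries
`i·ε₁, -i·ε₁, i·ε₂, -i·ε₂, …, i·εₘ, -i·εₘ` is unitarily equivalent to (the
complexification of) a real anti-symmetric matrix: `D = V * Ẽ * Vᴴ` with `V` unitary
and `Eᵀ = -E` real. -/
theorem paired_imaginary_diagonal_is_unitarily_real_antisymm (m : ℕ) (ε : Fin m → ℝ) :
    ∃ (E : Matrix (Fin (2 * m)) (Fin (2 * m)) ℝ)
      (V : Matrix (Fin (2 * m)) (Fin (2 * m)) ℂ),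
      Eᵀ = -E ∧ V ∈ Matrix.unitaryGroup (Fin (2 * m)) ℂ ∧
      Matrix.diagonal (fun j : Fin (2 * m) =>
          (if (j : ℕ) % 2 = 0 then Complex.I else -Complex.I) *
            (ε ⟨(j : ℕ) / 2, by have := j.isLt; omega⟩ : ℝ)) =
        V * E.map Complex.ofReal * Vᴴ := by
  set e := finTwoMulEquiv m
  refine ⟨(blockDiagonal fun k => !![0, ε k; -ε k, 0]).submatrix e e,
    (blockDiagonal fun _ => rotationDiagonalizer).submatrix e e, ?_, ?_, ?_⟩
  · rw [transpose_submatrix, blockDiagonal_transpose]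
    change _ = (-blockDiagonal fun k => !![0, ε k; -ε k, 0]).submatrix e e
    rw [← blockDiagonal_neg]
    congr 2
    ext k i j
    fin_cases i <;> fin_cases j <;> simp
  · rw [mem_unitaryGroup_iff, star_eq_conjTranspose, conjTranspose_submatrix,
      blockDiagonal_conjTranspose, submatrix_mul_equiv, ← blockDiagonal_mul]
    simp only [rotationDiagonalizer_mul_conjTranspose]
    rw [← Pi.one_def, blockDiagonal_one, submatrix_one_equiv]
  · rw [conjTranspose_submatrix, blockDiagonal_conjTranspose, ← submatrix_map,
      blockDiagonal_map _ _ Complex.ofReal_zero, submatrix_mul_equiv, submatrix_mul_equiv,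
      ← blockDiagonal_mul, ← blockDiagonal_mul]
    simp only [rotationDiagonalizer_conj]
    rw [blockDiagonal_diagonal, submatrix_diagonal_equiv]
    congr 1
    ext j
    have h₂ : (e j).2 = ⟨(j : ℕ) / 2, by omega⟩ := rfl
    have h₁ : (e j).1 = ⟨(j : ℕ) % 2, by omega⟩ := rfl
    rw [Function.comp_apply, h₁, h₂]
    rcases Nat.mod_two_eq_zero_or_one (j : ℕ) with h | h <;> simp [h]
end

section
/- Let Δ be an n×n complex matrix and let T be the 2n×2n complex block matrix T = fromBlocks ((1/2)•1) Δ Δᴴ ((-1/2)•1). Then z ∈ ℂ is an eigenvalue of T if and only if z² - 1/4 is an eigenvalue of Δ * Δᴴ. -/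
open Matrix

namespace Matrix

variable {m n K : Type*} [Fintype m] [DecidableEq m] [Fintype n] [DecidableEq n] [Field K]

/-- Determinant of a `2 × 2` block matrix with scalar diagonal blocks, the lower one nonzero. -/
theorem det_fromBlocks_smul_one_smul_one (a : K) {d : K} (hd : d ≠ 0) (B C : Matrix n n K) :
    (fromBlocks (a • 1) B C (d • 1)).det = ((a * d) • 1 - B * C).det := by
  have h : fromBlocks (a • 1) B C (d • 1) * fromBlocks (d • 1) 0 (-C) 1 =
      fromBlocks ((a * d) • 1 - B * C) B 0 (d • 1) := by
    simp [fromBlocks_multiply, smul_smul, sub_eq_add_neg, mul_comm a d]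
  have h_det := congrArg det h
  rw [det_mul, det_fromBlocks_zero₁₂, det_fromBlocks_zero₂₁, det_one, mul_one] at h_det
  refine mul_right_cancel₀ ?_ h_det
  simp [hd]

/-- Exchanging the two block rows and columns does not change the determinant. -/
theorem det_fromBlocks_swap (A : Matrix m m K) (B : Matrix m n K) (C : Matrix n m K)
    (D : Matrix n n K) : (fromBlocks A B C D).det = (fromBlocks D C B A).det := by
  rw [← det_submatrix_equiv_self (Equiv.sumComm n m) (fromBlocks A B C D)]
  simp

theorem det_smul_one_sub_mul_comm (c : K) (A B : Matrix n n K) :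
    (c • 1 - A * B).det = (c • 1 - B * A).det := by
  have h := congrArg (Polynomial.eval c) (charpoly_mul_comm A B)
  simpa [eval_charpoly, smul_one_eq_diagonal] using h

end Matrix

/-- For the block matrix `T = [[(1/2)·1, Δ], [Δᴴ, -(1/2)·1]]`, a complex
number `z` is an eigenvalue of `T` iff `z² - 1/4` is an eigenvalue of `Δ * Δᴴ`. -/
theorem block_hamiltonian_spectrum_iff (n : ℕ) (Δ : Matrix (Fin n) (Fin n) ℂ)
    (T : Matrix (Fin n ⊕ Fin n) (Fin n ⊕ Fin n) ℂ)
    (hT : T = Matrix.fromBlocks (((1 : ℂ) / 2) • 1) Δ Δᴴ ((-(1 : ℂ) / 2) • 1))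
    (z : ℂ) :
    z ∈ spectrum ℂ T ↔ z ^ 2 - 1 / 4 ∈ spectrum ℂ (Δ * Δᴴ) := by
  have h_sub : z • 1 - T = fromBlocks ((z - 1 / 2) • 1) (-Δ) (-Δᴴ) ((z + 1 / 2) • 1) := by
    rw [hT, ← fromBlocks_one, fromBlocks_smul, sub_eq_add_neg, fromBlocks_neg, fromBlocks_add]
    congr 1 <;> simp [add_smul, neg_div, sub_eq_add_neg]
  have h_det : (z • 1 - T).det = ((z ^ 2 - 1 / 4) • 1 - Δ * Δᴴ).det := by
    rw [h_sub]
    by_cases hz : z + 1 / 2 = 0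
    · have h_ne : z - 1 / 2 ≠ 0 := by
        rw [eq_neg_of_add_eq_zero_left hz]
        norm_num
      rw [det_fromBlocks_swap, det_fromBlocks_smul_one_smul_one _ h_ne, neg_mul_neg,
        det_smul_one_sub_mul_comm]
      congr 3
      ring
    · rw [det_fromBlocks_smul_one_smul_one _ hz, neg_mul_neg]
      congr 3
      ring
  simp only [spectrum.mem_iff, Algebra.algebraMap_eq_smul_one, isUnit_iff_isUnit_det, h_det]
end

section
/- Let Δ be an n×n complex matrix and let T be the 2n×2n complex block matrix T = fromBlocks ((1/2)•1) Δ Δᴴ ((-1/2)•1). Then T is Hermitian, and every eigenvalue z of T is real and satisfies z² ≥ 1/4, i.e., |z| ≥ 1/2. -/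
open Matrix

open scoped ComplexOrder in
theorem re_nonneg_and_im_eq_zero_of_mem_spectrum_conjTranspose_mul_self
    {m n : Type*} [Fintype m] [Fintype n] [DecidableEq n] {A : Matrix m n ℂ} {w : ℂ}
    (hw : w ∈ spectrum ℂ (Aᴴ * A)) : 0 ≤ w.re ∧ w.im = 0 := by
  have hnonneg : 0 ≤ w :=
    (posSemidef_iff_isHermitian_and_spectrum_nonneg.mp (posSemidef_conjTranspose_mul_self A)).2 hw
  obtain ⟨hre, him⟩ := Complex.le_def.mp hnonneg
  exact ⟨hre, him.symm⟩

/-- The block matrix `T = [[(1/2)·1, Δ], [Δᴴ, -(1/2)·1]]` is Hermitian and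
every eigenvalue `z` of `T` is real with `z² ≥ 1/4` (equivalently `|z| ≥ 1/2`). -/
theorem block_hamiltonian_hermitian_gap (n : ℕ) (Δ : Matrix (Fin n) (Fin n) ℂ)
    (T : Matrix (Fin n ⊕ Fin n) (Fin n ⊕ Fin n) ℂ)
    (hT : T = Matrix.fromBlocks (((1 : ℂ) / 2) • 1) Δ Δᴴ ((-(1 : ℂ) / 2) • 1)) :
    T.IsHermitian ∧
      ∀ z ∈ spectrum ℂ T, z.im = 0 ∧ (1 / 4 : ℝ) ≤ z.re ^ 2 := by
  refine ⟨?_, fun z hz => ?_⟩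
  · rw [hT, isHermitian_fromBlocks_iff]
    simp [IsHermitian, conjTranspose_smul]
  · have hsq : T ^ 2 =
        (fromBlocks 0 Δ Δᴴ 0)ᴴ * fromBlocks 0 Δ Δᴴ 0 + algebraMap ℂ _ (1 / 4) := by
      rw [hT, pow_two, fromBlocks_conjTranspose, fromBlocks_multiply, fromBlocks_multiply,
        Algebra.algebraMap_eq_smul_one, ← fromBlocks_one, fromBlocks_smul, fromBlocks_add,
        fromBlocks_inj]
      refine ⟨?_, ?_, ?_, ?_⟩ <;> simp [smul_smul] <;> module
    have hmem : z ^ 2 - 1 / 4 ∈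
        spectrum ℂ ((fromBlocks 0 Δ Δᴴ 0)ᴴ * fromBlocks 0 Δ Δᴴ 0) := by
      rw [← spectrum.add_mem_add_iff (s := 1 / 4), sub_add_cancel, add_comm (algebraMap _ _ _),
        ← hsq]
      exact spectrum.pow_mem_pow T 2 hz
    obtain ⟨hre, him⟩ := re_nonneg_and_im_eq_zero_of_mem_spectrum_conjTranspose_mul_self hmem
    simp [pow_two] at hre him
    have hprod : z.re * z.im = 0 := by linarith
    rcases mul_eq_zero.mp hprod with h | h
    · rw [h] at hre
      nlinarith [sq_nonneg z.im]
    · refine ⟨h, ?_⟩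
      rw [h] at hre
      linarith
end

section
/- Let Δ be an n×n complex matrix and let T be the 2n×2n complex block matrix T = fromBlocks ((1/2)•1) Δ Δᴴ ((-1/2)•1). If μ ≥ 0 is a real eigenvalue of Δ * Δᴴ, then both √(μ + 1/4) and -√(μ + 1/4) are eigenvalues of T. -/
open Matrix

theorem Matrix.mem_spectrum_iff_exists_mulVec_eq_smul {ι K : Type*} [Fintype ι] [DecidableEq ι]
    [Field K] {A : Matrix ι ι K} {z : K} :
    z ∈ spectrum K A ↔ ∃ v ≠ 0, A *ᵥ v = z • v := by
  rw [spectrum.mem_iff, isUnit_iff_isUnit_det, isUnit_iff_ne_zero, not_not,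
    ← exists_mulVec_eq_zero_iff]
  simp only [Algebra.algebraMap_eq_smul_one, sub_mulVec, smul_mulVec, one_mulVec, sub_eq_zero,
    eq_comm]

/-- A square root of `a ^ 2 + μ`, with `μ` an eigenvalue of `Δ * Δᴴ`, is an eigenvalue of
`[[a·1, Δ], [Δᴴ, -a·1]]`. -/
theorem Matrix.mem_spectrum_fromBlocks_smul_one {ι : Type*} [Fintype ι] [DecidableEq ι]
    {Δ : Matrix ι ι ℂ} {a μ z : ℂ} (h : μ ∈ spectrum ℂ (Δ * Δᴴ)) (hz : z ^ 2 = a ^ 2 + μ) :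
    z ∈ spectrum ℂ (fromBlocks (a • 1) Δ Δᴴ ((-a) • 1)) := by
  rw [mem_spectrum_iff_exists_mulVec_eq_smul] at h ⊢
  obtain ⟨v, hv, hΔv⟩ := h
  by_cases hza : z + a = 0
  · obtain rfl : z = -a := eq_neg_of_add_eq_zero_left hza
    obtain rfl : μ = 0 := by linear_combination -hz
    have hdet : Δ.det = 0 := by
      have : (Δ * Δᴴ).det = 0 := exists_mulVec_eq_zero_iff.mp ⟨v, hv, by simpa using hΔv⟩
      simpa [det_mul, det_conjTranspose] using this
    obtain ⟨w, hw, hΔw⟩ := exists_mulVec_eq_zero_iff.mpr hdet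
    refine ⟨Sum.elim 0 w, fun h0 => hw (funext fun i => congrFun h0 (Sum.inr i)), ?_⟩
    rw [fromBlocks_mulVec]
    ext (i | i) <;> simp [hΔw, neg_mulVec, smul_mulVec]
  · refine ⟨Sum.elim ((z + a) • v) (Δᴴ *ᵥ v), fun h0 => ?_, ?_⟩
    · exact (smul_ne_zero hza hv) (funext fun i => congrFun h0 (Sum.inl i))
    · rw [fromBlocks_mulVec]
      ext (i | i)
      · simp [hΔv, smul_mulVec]
        linear_combination -v i * hz
      · simp [smul_mulVec, mulVec_smul, neg_mulVec]
        ring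

/-- If `μ ≥ 0` is a real eigenvalue of `Δ * Δᴴ`, then both
`√(μ + 1/4)` and `-√(μ + 1/4)` are eigenvalues of the block matrix
`T = [[(1/2)·1, Δ], [Δᴴ, -(1/2)·1]]`. -/
theorem block_hamiltonian_eigenvalues_from_singular (n : ℕ)
    (Δ : Matrix (Fin n) (Fin n) ℂ)
    (T : Matrix (Fin n ⊕ Fin n) (Fin n ⊕ Fin n) ℂ)
    (hT : T = Matrix.fromBlocks (((1 : ℂ) / 2) • 1) Δ Δᴴ ((-(1 : ℂ) / 2) • 1))
    (μ : ℝ) (hμ : 0 ≤ μ) (h : (μ : ℂ) ∈ spectrum ℂ (Δ * Δᴴ)) :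
    ((Real.sqrt (μ + 1 / 4) : ℝ) : ℂ) ∈ spectrum ℂ T ∧
      ((-Real.sqrt (μ + 1 / 4) : ℝ) : ℂ) ∈ spectrum ℂ T := by
  have hsq : ((Real.sqrt (μ + 1 / 4) : ℝ) : ℂ) ^ 2 = (1 / 2) ^ 2 + μ := by
    rw [← Complex.ofReal_pow, Real.sq_sqrt (by positivity)]
    push_cast
    ring
  rw [hT, neg_div]
  exact ⟨mem_spectrum_fromBlocks_smul_one h hsq,
    mem_spectrum_fromBlocks_smul_one h (by rw [Complex.ofReal_neg, neg_sq, hsq])⟩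
end
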